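/- Let V : ℝ^N → [0,∞) be lower semicontinuous and assume that for every x ∈ ℝ^N∖{0} and every (p,Y) ∈ J^{2,−}V(x) there exists ᾱ ∈ A with σ(x,ᾱ)^T p = 0 and −p·f(x,ᾱ) − trace(a(x,ᾱ)Y) ≥ 0. For μ > 0 and λ > 0 define ψ_λ : ℝ → ℝ by ψ_λ(t) = 0 for t ≤ μ, ψ_λ(t) = λ(t−μ) for μ ≤ t ≤ μ + 1/λ, and ψ_λ(t) = 1 for t ≥ μ + 1/λ. Then ψ_λ ∘ V is a viscosity supersolution of max_{α∈A}{ −Du·f(x,α) − trace(a(x,α)D²u) } = 0 on ℝ^N∖{0}, i.e. for every x ≠ 0 and every (p,Y) ∈ J^{2,−}(ψ_λ∘V)(x), sup_{α∈A}{ −p·f(x,α) − trace(a(x,α)Y) } ≥ 0. -/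

import Mathlib

open scoped BigOperators

noncomputable section

/-- Euclidean dot product on `ℝ^N`. -/
def dotP {N : ℕ} (p q : EuclideanSpace ℝ (Fin N)) : ℝ := ∑ i, p i * q i

/-- Quadratic form `v ⬝ (Y v)` of an `N × N` matrix. -/
def quadF {N : ℕ} (Y : Matrix (Fin N) (Fin N) ℝ) (v : EuclideanSpace ℝ (Fin N)) : ℝ :=
  ∑ i, v i * ∑ j, Y i j * v j

/-- Second-order subjet `J^{2,-}V(x)`: pairs `(p,Y)` with `Y` symmetric such that
`V(y) ≥ V(x) + p·(y-x) + (1/2)(y-x)·Y(y-x) + o(|y-x|²)` as `y → x`. -/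
def InSubjet {N : ℕ} (V : EuclideanSpace ℝ (Fin N) → ℝ)
    (x p : EuclideanSpace ℝ (Fin N)) (Y : Matrix (Fin N) (Fin N) ℝ) : Prop :=
  Y.IsSymm ∧ ∀ ε > 0, ∃ δ > 0, ∀ y : EuclideanSpace ℝ (Fin N), ‖y - x‖ < δ →
    V y ≥ V x + dotP p (y - x) + (1/2) * quadF Y (y - x) - ε * ‖y - x‖ ^ 2

/-- The diffusion matrix `a = (1/2) σ σᵀ`. -/
def aMat {N M : ℕ} (σ : Matrix (Fin N) (Fin M) ℝ) : Matrix (Fin N) (Fin N) ℝ :=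
  (1/2 : ℝ) • (σ * σ.transpose)

open Matrix

section Algebra

variable {N M : ℕ}

lemma dotP_add_left (p q v : EuclideanSpace ℝ (Fin N)) :
    dotP (p + q) v = dotP p v + dotP q v := by
  simp [dotP, add_mul, Finset.sum_add_distrib]

lemma dotP_add_right (p v w : EuclideanSpace ℝ (Fin N)) :
    dotP p (v + w) = dotP p v + dotP p w := by
  simp [dotP, mul_add, Finset.sum_add_distrib]

lemma dotP_smul_left (c : ℝ) (p v : EuclideanSpace ℝ (Fin N)) :
    dotP (c • p) v = c * dotP p v := by
  simp [dotP, Finset.mul_sum, mul_assoc]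

lemma dotP_smul_right (c : ℝ) (p v : EuclideanSpace ℝ (Fin N)) :
    dotP p (c • v) = c * dotP p v := by
  simp [dotP, Finset.mul_sum, mul_left_comm]

lemma dotP_self (v : EuclideanSpace ℝ (Fin N)) : dotP v v = ‖v‖ ^ 2 := by
  rw [EuclideanSpace.norm_sq_eq]
  simp [dotP, sq]

lemma quadF_eq (Y : Matrix (Fin N) (Fin N) ℝ) (v : EuclideanSpace ℝ (Fin N)) :
    quadF Y v = v.ofLp ⬝ᵥ (Y *ᵥ v.ofLp) := rfl

lemma quadF_smul_right (Y : Matrix (Fin N) (Fin N) ℝ) (c : ℝ) (v : EuclideanSpace ℝ (Fin N)) :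
    quadF Y (c • v) = c ^ 2 * quadF Y v := by
  simp [quadF_eq, mulVec_smul]; ring

lemma quadF_add_left (Y Z : Matrix (Fin N) (Fin N) ℝ) (v : EuclideanSpace ℝ (Fin N)) :
    quadF (Y + Z) v = quadF Y v + quadF Z v := by
  simp [quadF_eq, add_mulVec]

lemma quadF_smul_left (c : ℝ) (Y : Matrix (Fin N) (Fin N) ℝ) (v : EuclideanSpace ℝ (Fin N)) :
    quadF (c • Y) v = c * quadF Y v := by
  simp [quadF_eq, smul_mulVec]

lemma quadF_one (v : EuclideanSpace ℝ (Fin N)) : quadF 1 v = ‖v‖ ^ 2 := by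
  rw [← dotP_self, quadF_eq, one_mulVec]; rfl

lemma quadF_vecMulVec (b v : EuclideanSpace ℝ (Fin N)) :
    quadF (vecMulVec b.ofLp b.ofLp) v = dotP b v ^ 2 := by
  have h : dotP b v = b.ofLp ⬝ᵥ v.ofLp := rfl
  rw [quadF_eq, vecMulVec_mulVec, h, sq]
  simp [dotProduct_comm]

lemma quadF_add_right {Y : Matrix (Fin N) (Fin N) ℝ} (hY : Y.IsSymm)
    (v w : EuclideanSpace ℝ (Fin N)) :
    quadF Y (v + w) = quadF Y v + 2 * dotP (WithLp.toLp 2 (Y *ᵥ v.ofLp)) w + quadF Y w := by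
  have h : dotP (WithLp.toLp 2 (Y *ᵥ v.ofLp)) w = (Y *ᵥ v.ofLp) ⬝ᵥ w.ofLp := rfl
  have h2 : v.ofLp ⬝ᵥ (Y *ᵥ w.ofLp) = (Y *ᵥ v.ofLp) ⬝ᵥ w.ofLp := by
    rw [dotProduct_mulVec, ← mulVec_transpose, hY.eq]
  simp only [quadF_eq, h, WithLp.ofLp_add, mulVec_add, dotProduct_add, add_dotProduct, h2]
  rw [dotProduct_comm w.ofLp (Y *ᵥ v.ofLp)]
  ring

lemma abs_quadF_le (Y : Matrix (Fin N) (Fin N) ℝ) :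
    ∃ C, 0 ≤ C ∧ ∀ v : EuclideanSpace ℝ (Fin N), |quadF Y v| ≤ C * ‖v‖ ^ 2 := by
  refine ⟨∑ i, ∑ j, |Y i j|, by positivity, fun v => ?_⟩
  rw [quadF, Finset.sum_mul]
  refine (Finset.abs_sum_le_sum_abs _ _).trans (Finset.sum_le_sum fun i _ => ?_)
  rw [Finset.mul_sum, Finset.sum_mul]
  refine (Finset.abs_sum_le_sum_abs _ _).trans (Finset.sum_le_sum fun j _ => ?_)
  have hi : |v i| ≤ ‖v‖ := PiLp.norm_apply_le v i
  have hj : |v j| ≤ ‖v‖ := PiLp.norm_apply_le v j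
  calc |v i * (Y i j * v j)| = |Y i j| * (|v i| * |v j|) := by
        rw [abs_mul, abs_mul]; ring
    _ ≤ |Y i j| * (‖v‖ * ‖v‖) := by gcongr
    _ = _ := by ring

lemma trace_aMat_mul (s : Matrix (Fin N) (Fin M) ℝ) (Y : Matrix (Fin N) (Fin N) ℝ) :
    (aMat s * Y).trace = (1 / 2) * ∑ k, quadF Y (WithLp.toLp 2 (sᵀ k)) := by
  rw [aMat, smul_mul_assoc, trace_smul, smul_eq_mul, Matrix.mul_assoc, trace_mul_comm,
    Matrix.mul_assoc, trace]
  rfl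

lemma trace_aMat_mul_vecMulVec (s : Matrix (Fin N) (Fin M) ℝ) (b : EuclideanSpace ℝ (Fin N))
    (hb : sᵀ *ᵥ b.ofLp = 0) : (aMat s * vecMulVec b.ofLp b.ofLp).trace = 0 := by
  rw [trace_aMat_mul]
  have h (k : Fin M) : dotP b (WithLp.toLp 2 (sᵀ k)) = 0 := by
    have := congrFun hb k
    rw [mulVec, dotProduct_comm] at this
    exact this
  simp [quadF_vecMulVec, h]

end Algebra

section SmoothPositivePart

/-- A smooth strictly increasing approximation of the positive part. -/
def smoothPos (c s : ℝ) : ℝ := (s + √(s ^ 2 + c ^ 2)) / 2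

variable {c : ℝ}

lemma continuous_smoothPos : Continuous (smoothPos c) := by
  unfold smoothPos; fun_prop

lemma monotone_smoothPos : Monotone (smoothPos c) := by
  intro s t hst
  have h1 : -t ≤ √(t ^ 2 + c ^ 2) :=
    (neg_le_abs t).trans (Real.abs_le_sqrt (by nlinarith [sq_nonneg c]))
  have h2 := Real.sq_sqrt (show 0 ≤ t ^ 2 + c ^ 2 by positivity)
  have h3 := Real.sqrt_nonneg (t ^ 2 + c ^ 2)
  have h : √(s ^ 2 + c ^ 2) ≤ √(t ^ 2 + c ^ 2) + (t - s) := by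
    rw [Real.sqrt_le_iff]
    constructor
    · linarith
    · nlinarith [mul_nonneg (sub_nonneg.2 hst) (by linarith : 0 ≤ √(t ^ 2 + c ^ 2) + t)]
  unfold smoothPos
  linarith

lemma smoothPos_pos (hc : 0 < c) (s : ℝ) : 0 < smoothPos c s := by
  have h : |s| < √(s ^ 2 + c ^ 2) := by
    rw [Real.lt_sqrt (abs_nonneg s), sq_abs]
    nlinarith
  have := neg_abs_le s
  unfold smoothPos
  linarith

lemma max_le_smoothPos (s : ℝ) : max s 0 ≤ smoothPos c s := by
  have h : |s| ≤ √(s ^ 2 + c ^ 2) := Real.abs_le_sqrt (by nlinarith [sq_nonneg c])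
  have := neg_abs_le s
  have := le_abs_self s
  unfold smoothPos
  exact max_le (by linarith) (by linarith)

lemma smoothPos_le (hc : 0 ≤ c) (s : ℝ) : smoothPos c s ≤ max s 0 + c / 2 := by
  have h : √(s ^ 2 + c ^ 2) ≤ |s| + c := by
    rw [Real.sqrt_le_iff]
    refine ⟨by positivity, ?_⟩
    nlinarith [sq_abs s, mul_nonneg (abs_nonneg s) hc]
  unfold smoothPos
  rcases abs_cases s with ⟨h1, h2⟩ | ⟨h1, h2⟩
  · rw [max_eq_left h2]; linarith
  · rw [max_eq_right h2.le]; linarith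

lemma smoothPos_inverse (hc : 0 < c) (s : ℝ) :
    s = smoothPos c s - c ^ 2 / 4 / smoothPos c s := by
  have h := smoothPos_pos hc s
  field_simp
  unfold smoothPos
  nlinarith [Real.sq_sqrt (show 0 ≤ s ^ 2 + c ^ 2 by positivity)]

lemma le_of_smoothPos_add_le (hc : 0 < c) {s t e : ℝ} (he : |e| ≤ smoothPos c s / 2)
    (h : smoothPos c s + e ≤ smoothPos c t) :
    s + (1 + c ^ 2 / 4 / smoothPos c s ^ 2) * e - c ^ 2 / 2 / smoothPos c s ^ 3 * e ^ 2 ≤ t := by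
  have hs := smoothPos_inverse hc s
  have ht := smoothPos_inverse hc t
  have hw := smoothPos_pos hc s
  set w := smoothPos c s
  set z := smoothPos c t
  have he' := abs_le.1 he
  have hwe : 0 < w + e := by linarith
  have h1 : c ^ 2 / 4 / z ≤ c ^ 2 / 4 / (w + e) := by gcongr
  have h2 : 1 / (w + e) ≤ 1 / w - e / w ^ 2 + 2 * e ^ 2 / w ^ 3 := by
    rw [div_le_iff₀ hwe]
    have : (1 / w - e / w ^ 2 + 2 * e ^ 2 / w ^ 3) * (w + e) = 1 + e ^ 2 * (w + 2 * e) / w ^ 3 := by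
      field_simp; ring
    rw [this]
    have : 0 ≤ e ^ 2 * (w + 2 * e) / w ^ 3 :=
      div_nonneg (mul_nonneg (sq_nonneg e) (by linarith)) (by positivity)
    linarith
  have h3 : c ^ 2 / 4 / (w + e) ≤ c ^ 2 / 4 * (1 / w - e / w ^ 2 + 2 * e ^ 2 / w ^ 3) := by
    rw [div_eq_mul_one_div (c ^ 2 / 4) (w + e)]
    gcongr
  have h4 : c ^ 2 / 4 * (1 / w - e / w ^ 2 + 2 * e ^ 2 / w ^ 3)
      = c ^ 2 / 4 / w - c ^ 2 / 4 / w ^ 2 * e + c ^ 2 / 2 / w ^ 3 * e ^ 2 := by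
    field_simp; ring
  rw [h4] at h3
  nlinarith

end SmoothPositivePart

section Subjet

variable {N M : ℕ}

lemma isSymm_vecMulVec_self (b : Fin N → ℝ) : (vecMulVec b b).IsSymm := by
  ext i j; simp [vecMulVec_apply, mul_comm]

lemma inSubjet_of_le {V : EuclideanSpace ℝ (Fin N) → ℝ} {x b : EuclideanSpace ℝ (Fin N)}
    {Q : Matrix (Fin N) (Fin N) ℝ} (hQ : Q.IsSymm) {K B δ : ℝ} (hB : 0 ≤ B) (hδ : 0 < δ)
    (h : ∀ y, ‖y - x‖ < δ →
      V x + K * (dotP b (y - x) + (1 / 2) * quadF Q (y - x))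
        - B * (dotP b (y - x) + (1 / 2) * quadF Q (y - x)) ^ 2 ≤ V y) :
    InSubjet V x (K • b) (K • Q + (-(4 * B)) • vecMulVec b.ofLp b.ofLp) := by
  refine ⟨(hQ.smul K).add ((isSymm_vecMulVec_self _).smul _), fun ε hε => ?_⟩
  obtain ⟨C, hC, hbound⟩ := abs_quadF_le Q
  have hd : 0 < B * C ^ 2 + 1 := by positivity
  refine ⟨min δ (min 1 (ε / (B * C ^ 2 + 1))), by positivity, fun y hy => ?_⟩
  obtain ⟨hy1, hy⟩ := lt_min_iff.1 hy
  obtain ⟨hy2, hy3⟩ := lt_min_iff.1 hy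
  have hy4 := h y hy1
  have hq := hbound (y - x)
  set v := y - x
  rw [dotP_smul_left, quadF_add_left, quadF_smul_left, quadF_smul_left, quadF_vecMulVec]
  have hq2 : quadF Q v ^ 2 ≤ (C * ‖v‖ ^ 2) ^ 2 := sq_le_sq' (abs_le.1 hq).1 (abs_le.1 hq).2
  have hv := norm_nonneg v
  have hvv : ‖v‖ ^ 2 ≤ ε / (B * C ^ 2 + 1) := by nlinarith
  rw [le_div_iff₀ hd] at hvv
  have h4 : B * (C * ‖v‖ ^ 2) ^ 2 ≤ ε * ‖v‖ ^ 2 := by nlinarith [sq_nonneg ‖v‖]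
  have h5 := mul_le_mul_of_nonneg_left hq2 hB
  have h6 := mul_nonneg hB (sq_nonneg (dotP b v - 1 / 2 * quadF Q v))
  have h7 := mul_nonneg hB (sq_nonneg (quadF Q v))
  nlinarith

/-- A second-order expansion that is nonpositive up to `o(|v|²)` has nonpositive first- and
second-order parts. -/
lemma dotP_nonpos_and_quadF_nonpos {p : EuclideanSpace ℝ (Fin N)} {Y : Matrix (Fin N) (Fin N) ℝ}
    (h : ∀ ε > 0, ∃ δ > 0, ∀ v : EuclideanSpace ℝ (Fin N), ‖v‖ < δ →
      dotP p v + (1 / 2) * quadF Y v ≤ ε * ‖v‖ ^ 2) (w : EuclideanSpace ℝ (Fin N)) :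
    dotP p w ≤ 0 ∧ quadF Y w ≤ 0 := by
  have key : ∀ ε > 0, ∀ w : EuclideanSpace ℝ (Fin N), ∃ t₀ > 0, ∀ t, |t| < t₀ →
      t * dotP p w + (1 / 2) * (t ^ 2 * quadF Y w) ≤ ε * (t ^ 2 * ‖w‖ ^ 2) := by
    intro ε hε w
    obtain ⟨δ, hδ, H⟩ := h ε hε
    refine ⟨δ / (‖w‖ + 1), by positivity, fun t ht => ?_⟩
    have := H (t • w) (by
      rw [lt_div_iff₀ (by positivity)] at ht
      rw [norm_smul, Real.norm_eq_abs]
      nlinarith [abs_nonneg t])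
    rwa [dotP_smul_right, quadF_smul_right, norm_smul, mul_pow, Real.norm_eq_abs, sq_abs] at this
  constructor
  · by_contra! hp
    obtain ⟨t₀, ht₀, H⟩ := key 1 one_pos w
    set D := 1 * ‖w‖ ^ 2 - (1 / 2) * quadF Y w with hD
    have ht : 0 < min (t₀ / 2) (dotP p w / (|D| + 1) / 2) := by positivity
    set t := min (t₀ / 2) (dotP p w / (|D| + 1) / 2)
    have h1 := H t (by rw [abs_of_pos ht]; exact (min_le_left _ _).trans_lt (by linarith))
    have h2 : t * (|D| + 1) ≤ dotP p w / 2 := by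
      have : t ≤ dotP p w / (|D| + 1) / 2 := min_le_right _ _
      calc t * (|D| + 1) ≤ dotP p w / (|D| + 1) / 2 * (|D| + 1) := by gcongr
        _ = dotP p w / 2 := by field_simp
    have h3 : t * dotP p w ≤ t * (t * D) := by rw [hD]; linarith
    have h4 := le_of_mul_le_mul_left h3 ht
    nlinarith [le_abs_self D]
  · refine le_of_forall_pos_le_add fun ε hε => ?_
    obtain ⟨t₀, ht₀, H⟩ := key (ε / (2 * (‖w‖ ^ 2 + 1))) (by positivity) w
    have h1 := H (t₀ / 2) (by rw [abs_of_pos (by positivity)]; linarith)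
    have h2 := H (-(t₀ / 2)) (by rw [abs_neg, abs_of_pos (by positivity)]; linarith)
    have h3 : (t₀ / 2) ^ 2 * quadF Y w ≤
        (t₀ / 2) ^ 2 * (2 * (ε / (2 * (‖w‖ ^ 2 + 1)) * ‖w‖ ^ 2)) := by linarith
    have h4 := le_of_mul_le_mul_left h3 (by positivity)
    have h5 : 2 * (ε / (2 * (‖w‖ ^ 2 + 1)) * ‖w‖ ^ 2) ≤ ε := by
      have : 2 * (ε / (2 * (‖w‖ ^ 2 + 1)) * ‖w‖ ^ 2) = ε * (‖w‖ ^ 2 / (‖w‖ ^ 2 + 1)) := by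
        field_simp
      rw [this]
      have : ‖w‖ ^ 2 / (‖w‖ ^ 2 + 1) ≤ 1 := (div_le_one (by positivity)).2 (by linarith)
      nlinarith
    linarith

lemma continuous_dotP {X : Type*} [TopologicalSpace X] {b v : X → EuclideanSpace ℝ (Fin N)}
    (hb : Continuous b) (hv : Continuous v) : Continuous fun z => dotP (b z) (v z) := by
  unfold dotP; fun_prop

lemma continuous_quadF (Y : Matrix (Fin N) (Fin N) ℝ) : Continuous (quadF Y) := by
  unfold quadF; fun_prop

/-- A regularised level of `V` touched from below by a quadratic yields the Hamilton-Jacobi-Bellman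
inequality for the jet of that quadratic. -/
lemma exists_hamiltonian_nonneg_of_touching {A : Type*}
    {g : A → EuclideanSpace ℝ (Fin N)} {s : A → Matrix (Fin N) (Fin M) ℝ}
    {V : EuclideanSpace ℝ (Fin N) → ℝ} {x b : EuclideanSpace ℝ (Fin N)}
    (hV : ∀ p Y, InSubjet V x p Y → ∃ α : A, (s α)ᵀ *ᵥ (fun i => p i) = 0 ∧
      0 ≤ -dotP p (g α) - (aMat (s α) * Y).trace)
    {μ lam c δ : ℝ} (hlam : 0 < lam) (hc : 0 < c) (hδ : 0 < δ)
    {Q : Matrix (Fin N) (Fin N) ℝ} (hQ : Q.IsSymm)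
    (h : ∀ y, ‖y - x‖ < δ → lam * smoothPos c (V x - μ)
      + (dotP b (y - x) + (1 / 2) * quadF Q (y - x)) ≤ lam * smoothPos c (V y - μ)) :
    ∃ α, 0 ≤ -dotP b (g α) - (aMat (s α) * Q).trace := by
  have hw := smoothPos_pos hc (V x - μ)
  set w := smoothPos c (V x - μ) with hwdef
  have hcont : Continuous fun y => (dotP b (y - x) + (1 / 2) * quadF Q (y - x)) / lam := by
    have h1 := continuous_dotP (N := N) (b := fun _ => b) continuous_const
      (continuous_id.sub (continuous_const (y := x)))
    have h2 := (continuous_quadF Q).comp (continuous_id.sub (continuous_const (y := x)))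
    exact (h1.add (continuous_const.mul h2)).div_const lam
  obtain ⟨η, hη, hsmall⟩ := Metric.continuous_iff.1 hcont x (w / 2) (by positivity)
  have hjet : InSubjet V x (((1 + c ^ 2 / 4 / w ^ 2) / lam) • b)
      (((1 + c ^ 2 / 4 / w ^ 2) / lam) • Q
        + (-(4 * (c ^ 2 / 2 / w ^ 3 / lam ^ 2))) • vecMulVec b.ofLp b.ofLp) := by
    refine inSubjet_of_le (B := c ^ 2 / 2 / w ^ 3 / lam ^ 2) (δ := min δ η) hQ (by positivity)
      (by positivity) fun y hy => ?_
    obtain ⟨hy1, hy2⟩ := lt_min_iff.1 hy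
    have h1 := h y hy1
    have h2 := hsmall y (by rwa [dist_eq_norm])
    have h0 : (dotP b (x - x) + (1 / 2) * quadF Q (x - x)) / lam = 0 := by simp [dotP, quadF]
    rw [h0, Real.dist_eq, sub_zero] at h2
    set d := dotP b (y - x) + (1 / 2) * quadF Q (y - x)
    have h3 : w + d / lam ≤ smoothPos c (V y - μ) := by
      have : lam * (w + d / lam) = lam * w + d := by field_simp
      exact le_of_mul_le_mul_left (this.trans_le h1) hlam
    have h4 := le_of_smoothPos_add_le hc h2.le h3
    rw [← hwdef] at h4
    have e1 : (1 + c ^ 2 / 4 / w ^ 2) / lam * d = (1 + c ^ 2 / 4 / w ^ 2) * (d / lam) := by ring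
    have e2 : c ^ 2 / 2 / w ^ 3 / lam ^ 2 * d ^ 2 = c ^ 2 / 2 / w ^ 3 * (d / lam) ^ 2 := by
      rw [div_pow]; ring
    rw [e1, e2]
    linarith
  obtain ⟨α, hα, hH⟩ := hV _ _ hjet
  have hK : 0 < (1 + c ^ 2 / 4 / w ^ 2) / lam := by positivity
  generalize (1 + c ^ 2 / 4 / w ^ 2) / lam = K at hα hH hK
  have hb : (s α)ᵀ *ᵥ b.ofLp = 0 := by
    have : (s α)ᵀ *ᵥ (K • b.ofLp) = 0 := hα
    rw [mulVec_smul] at this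
    exact (smul_eq_zero.1 this).resolve_left hK.ne'
  rw [Matrix.mul_add, Matrix.mul_smul, Matrix.mul_smul, trace_add, trace_smul, trace_smul,
    trace_aMat_mul_vecMulVec _ _ hb, dotP_smul_left] at hH
  simp only [smul_eq_mul] at hH
  exact ⟨α, nonneg_of_mul_nonneg_right (by linarith : 0 ≤ K * _) hK⟩

/-- Perturbed minimisation: a subjet of `lam * (V - μ)⁺` gives, near the base point, points where
the regularised level of `V` is touched from below by a nearby quadratic. -/
lemma exists_touching_near {V : EuclideanSpace ℝ (Fin N) → ℝ} (hlsc : LowerSemicontinuous V)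
    {x p : EuclideanSpace ℝ (Fin N)} {Y : Matrix (Fin N) (Fin N) ℝ} {μ lam : ℝ} (hlam : 0 < lam)
    (h : InSubjet (fun y => lam * max (V y - μ) 0) x p Y) {ε η : ℝ} (hε : 0 < ε) (hη : 0 < η) :
    ∃ x₀, ‖x₀ - x‖ < η ∧ ∃ c > 0, ∃ δ > 0, ∀ y, ‖y - x₀‖ < δ →
      lam * smoothPos c (V x₀ - μ)
        + (dotP (p + WithLp.toLp 2 ((Y - (4 * ε) • 1) *ᵥ (x₀ - x).ofLp)) (y - x₀)
          + (1 / 2) * quadF (Y - (4 * ε) • 1) (y - x₀)) ≤ lam * smoothPos c (V y - μ) := by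
  obtain ⟨hY, h⟩ := h
  obtain ⟨δ, hδ, hjet⟩ := h ε hε
  set r := min (δ / 2) η with hr_def
  have hr : 0 < r := by positivity
  set c := ε * r ^ 2 / lam with hc_def
  have hc : 0 < c := by positivity
  have hQ : (Y - (4 * ε) • 1).IsSymm := hY.sub (isSymm_one.smul _)
  have hquad (v : EuclideanSpace ℝ (Fin N)) :
      quadF (Y - (4 * ε) • 1) v = quadF Y v - 4 * ε * ‖v‖ ^ 2 := by
    rw [sub_eq_add_neg, ← neg_smul, quadF_add_left, quadF_smul_left, quadF_one]; ring
  set Q := Y - (4 * ε) • (1 : Matrix (Fin N) (Fin N) ℝ)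
  let q : EuclideanSpace ℝ (Fin N) → ℝ := fun y => dotP p (y - x) + (1 / 2) * quadF Q (y - x)
  have hq : Continuous q := by
    have h1 := continuous_dotP (N := N) (b := fun _ => p) continuous_const
      (continuous_id.sub (continuous_const (y := x)))
    have h2 := (continuous_quadF Q).comp (continuous_id.sub (continuous_const (y := x)))
    exact h1.add (continuous_const.mul h2)
  have hG : LowerSemicontinuous fun y => lam * smoothPos c (V y - μ) := by
    have h1 : Continuous fun t => lam * smoothPos c (t - μ) :=
      continuous_const.mul (continuous_smoothPos.comp (continuous_id.sub continuous_const))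
    refine h1.comp_lowerSemicontinuous hlsc fun s t hst => ?_
    exact mul_le_mul_of_nonneg_left (monotone_smoothPos (by linarith)) hlam.le
  have hF : LowerSemicontinuous fun y => lam * smoothPos c (V y - μ) + -q y :=
    hG.add hq.neg.lowerSemicontinuous
  obtain ⟨x₀, hx₀, hmin⟩ := (hF.lowerSemicontinuousOn (Metric.closedBall x r)).exists_isMinOn
    ⟨x, Metric.mem_closedBall_self hr.le⟩ (isCompact_closedBall x r)
  rw [Metric.mem_closedBall, dist_eq_norm] at hx₀
  have hqx : q x = 0 := by simp [q, dotP, quadF]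
  have hlt : ‖x₀ - x‖ < r := by
    have h1 : lam * smoothPos c (V x₀ - μ) + -q x₀ ≤ lam * smoothPos c (V x - μ) + -q x :=
      hmin (Metric.mem_closedBall_self hr.le)
    have h2 := hjet x₀ (hx₀.trans_lt ((min_le_left _ _).trans_lt (by linarith)))
    have h3 := mul_le_mul_of_nonneg_left (smoothPos_le hc.le (V x - μ)) hlam.le
    have h4 := mul_le_mul_of_nonneg_left (max_le_smoothPos (c := c) (V x₀ - μ)) hlam.le
    have h5 : lam * c = ε * r ^ 2 := by rw [hc_def]; field_simp
    have h6 : q x₀ = dotP p (x₀ - x) + (1 / 2) * (quadF Y (x₀ - x) - 4 * ε * ‖x₀ - x‖ ^ 2) := by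
      simp only [q, hquad]
    simp only at h2
    have h7 : ε * ‖x₀ - x‖ ^ 2 < ε * r ^ 2 := by
      have : 0 < ε * r ^ 2 := by positivity
      nlinarith
    exact lt_of_pow_lt_pow_left₀ 2 hr.le (lt_of_mul_lt_mul_left h7 hε.le)
  refine ⟨x₀, hlt.trans_le (min_le_right _ _), c, hc, r - ‖x₀ - x‖, sub_pos.2 hlt, fun y hy => ?_⟩
  have hy' : y - x = (x₀ - x) + (y - x₀) := by abel
  have h1 : lam * smoothPos c (V x₀ - μ) + -q x₀ ≤ lam * smoothPos c (V y - μ) + -q y :=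
    hmin (by
      rw [Metric.mem_closedBall, dist_eq_norm, hy']
      exact (norm_add_le _ _).trans (by linarith))
  have h2 : q y = q x₀ + (dotP (p + WithLp.toLp 2 (Q *ᵥ (x₀ - x).ofLp)) (y - x₀)
      + (1 / 2) * quadF Q (y - x₀)) := by
    simp only [q]
    rw [hy', dotP_add_right, quadF_add_right hQ, dotP_add_left]
    ring
  linarith

end Subjet

/-- if a l.s.c. nonnegative `V` satisfies the constrained HJB supersolution
condition, then for `μ, λ > 0` the truncation `ψ_λ ∘ V`, where `ψ_λ(t) = 0` for `t ≤ μ`,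
`ψ_λ(t) = λ(t-μ)` for `μ ≤ t ≤ μ + 1/λ`, `ψ_λ(t) = 1` for `t ≥ μ + 1/λ`, is a viscosity
supersolution of `max_α { -Du·f - trace(a D²u) } = 0` on `ℝ^N \ {0}`. -/
theorem stmt2 {N M : ℕ} {A : Type*} [MetricSpace A] [CompactSpace A] [Nonempty A]
    (f : EuclideanSpace ℝ (Fin N) → A → EuclideanSpace ℝ (Fin N))
    (σ : EuclideanSpace ℝ (Fin N) → A → Matrix (Fin N) (Fin M) ℝ)
    (hf : Continuous fun q : EuclideanSpace ℝ (Fin N) × A => f q.1 q.2)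
    (hσ : Continuous fun q : EuclideanSpace ℝ (Fin N) × A => σ q.1 q.2)
    (V : EuclideanSpace ℝ (Fin N) → ℝ) (hV0 : ∀ x, 0 ≤ V x)
    (hlsc : LowerSemicontinuous V)
    (hV : ∀ x : EuclideanSpace ℝ (Fin N), x ≠ 0 → ∀ p Y, InSubjet V x p Y →
      ∃ α : A, (σ x α).transpose.mulVec (fun i => p i) = 0 ∧
        0 ≤ -dotP p (f x α) - (aMat (σ x α) * Y).trace)
    (μ lam : ℝ) (hμ : 0 < μ) (hlam : 0 < lam) (ψ : ℝ → ℝ)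
    (hψ1 : ∀ t ≤ μ, ψ t = 0)
    (hψ2 : ∀ t, μ ≤ t → t ≤ μ + 1 / lam → ψ t = lam * (t - μ))
    (hψ3 : ∀ t, μ + 1 / lam ≤ t → ψ t = 1) :
    ∀ x : EuclideanSpace ℝ (Fin N), x ≠ 0 → ∀ p Y, InSubjet (fun y => ψ (V y)) x p Y →
      0 ≤ ⨆ α : A, (-dotP p (f x α) - (aMat (σ x α) * Y).trace) := by
  intro x hx p Y hjet
  have hcont (b : EuclideanSpace ℝ (Fin N)) (Q : Matrix (Fin N) (Fin N) ℝ) :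
      Continuous fun α => -dotP b (f x α) - (aMat (σ x α) * Q).trace := by
    have h1 : Continuous fun α => f x α := hf.comp (by fun_prop : Continuous fun α : A => (x, α))
    have h2 : Continuous fun α => σ x α := hσ.comp (by fun_prop : Continuous fun α : A => (x, α))
    refine (continuous_dotP continuous_const h1).neg.sub ?_
    unfold aMat
    fun_prop
  suffices H : ∃ α, 0 ≤ -dotP p (f x α) - (aMat (σ x α) * Y).trace by
    obtain ⟨α, hα⟩ := H
    exact hα.trans (le_ciSup (isCompact_range (hcont p Y)).bddAbove α)
  have hpos : 0 < 1 / lam := by positivity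
  have hcancel : lam * (1 / lam) = 1 := by field_simp
  by_cases hVx : μ + 1 / lam ≤ V x
  · have hle (t : ℝ) : ψ t ≤ 1 := by
      rcases le_total t μ with h | h
      · rw [hψ1 t h]; exact zero_le_one
      rcases le_total t (μ + 1 / lam) with h' | h'
      · rw [hψ2 t h h']; nlinarith
      · rw [hψ3 t h']
    have hneg := dotP_nonpos_and_quadF_nonpos (p := p) (Y := Y) fun ε hε => by
      obtain ⟨δ, hδ, h⟩ := hjet.2 ε hε
      refine ⟨δ, hδ, fun v hv => ?_⟩
      have h1 := h (x + v) (by simpa using hv)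
      simp only [add_sub_cancel_left, hψ3 _ hVx] at h1
      have := hle (V (x + v))
      linarith
    obtain ⟨α⟩ := ‹Nonempty A›
    refine ⟨α, ?_⟩
    have h1 := (hneg (f x α)).1
    have h2 : ∑ k, quadF Y (WithLp.toLp 2 ((σ x α)ᵀ k)) ≤ 0 :=
      Finset.sum_nonpos fun k _ => (hneg _).2
    rw [trace_aMat_mul]
    linarith
  push Not at hVx
  have hle (t : ℝ) : ψ t ≤ lam * max (t - μ) 0 := by
    rcases le_total t μ with h | h
    · rw [hψ1 t h]; positivity
    rw [max_eq_left (by linarith)]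
    rcases le_total t (μ + 1 / lam) with h' | h'
    · rw [hψ2 t h h']
    · rw [hψ3 t h']; nlinarith
  have heq : ψ (V x) = lam * max (V x - μ) 0 := by
    rcases le_total (V x) μ with h | h
    · rw [hψ1 _ h, max_eq_right (by linarith), mul_zero]
    · rw [hψ2 _ h hVx.le, max_eq_left (by linarith)]
  have hjet' : InSubjet (fun y => lam * max (V y - μ) 0) x p Y := by
    refine ⟨hjet.1, fun ε hε => ?_⟩
    obtain ⟨δ, hδ, h⟩ := hjet.2 ε hε
    refine ⟨δ, hδ, fun y hy => ?_⟩
    have h1 := h y hy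
    have h2 := hle (V y)
    simp only [heq] at h1
    linarith
  let Φ : (EuclideanSpace ℝ (Fin N) × ℝ) × A → ℝ := fun z =>
    -dotP (p + WithLp.toLp 2 ((Y - (4 * z.1.2) • 1) *ᵥ (z.1.1 - x).ofLp)) (f z.1.1 z.2)
      - (aMat (σ z.1.1 z.2) * (Y - (4 * z.1.2) • 1)).trace
  have hΦ : Continuous Φ := by
    have h1 : Continuous fun z : (EuclideanSpace ℝ (Fin N) × ℝ) × A => f z.1.1 z.2 :=
      hf.comp (by fun_prop : Continuous fun z : (EuclideanSpace ℝ (Fin N) × ℝ) × A => (z.1.1, z.2))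
    have h2 : Continuous fun z : (EuclideanSpace ℝ (Fin N) × ℝ) × A => σ z.1.1 z.2 :=
      hσ.comp (by fun_prop : Continuous fun z : (EuclideanSpace ℝ (Fin N) × ℝ) × A => (z.1.1, z.2))
    refine (continuous_dotP ?_ h1).neg.sub ?_
    · fun_prop
    · unfold aMat
      fun_prop
  have hclosed : IsClosed (Prod.fst '' {z | 0 ≤ Φ z}) :=
    isClosedMap_fst_of_compactSpace _ (isClosed_le continuous_const hΦ)
  have hmem : (x, (0 : ℝ)) ∈ Prod.fst '' {z | 0 ≤ Φ z} := by
    rw [← hclosed.closure_eq, Metric.mem_closure_iff]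
    intro η hη
    have hxn : 0 < ‖x‖ := norm_pos_iff.2 hx
    obtain ⟨x₀, hx₀, c, hc, δ, hδ, htouch⟩ := exists_touching_near hlsc hlam hjet'
      (ε := η / 2) (η := min η ‖x‖) (by positivity) (by positivity)
    obtain ⟨hx₁, hx₂⟩ := lt_min_iff.1 hx₀
    have hne : x₀ ≠ 0 := by
      rintro rfl
      simp at hx₂
    obtain ⟨α, hα⟩ := exists_hamiltonian_nonneg_of_touching (g := f x₀) (s := σ x₀) (hV x₀ hne)
      hlam hc hδ (hjet.1.sub (isSymm_one.smul _)) htouch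
    refine ⟨(x₀, η / 2), ⟨((x₀, η / 2), α), hα, rfl⟩, ?_⟩
    rw [Prod.dist_eq, max_lt_iff]
    constructor
    · rwa [dist_comm, dist_eq_norm]
    · rw [Real.dist_eq, zero_sub, abs_neg, abs_of_pos (by positivity)]
      linarith
  obtain ⟨⟨⟨x', e⟩, α⟩, hα, hxe⟩ := hmem
  obtain ⟨rfl, rfl⟩ := Prod.mk.inj hxe
  exact ⟨α, by simpa [Φ] using hα⟩
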